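/- arXiv:1804.01074 — 3 statements merged into one kernel-verified Lean document; each statement's English description precedes it below -/
import Mathlib

section
/- Let H(q₁,q₂,p₁,p₂) = (1/2)(p₁² + p₂²) + (1/2)q₁² + (1/18)q₂² be the Fokas–Lagerstrom Hamiltonian on ℝ⁴. Then the function C_R = p₂²(p₁p₂ + q₁q₂) − (q₂²/3)(p₁p₂ + (1/9)q₁q₂) satisfies {H, C_R} = 0, i.e. C_R is a constant of motion. -/
/-- Canonical Poisson bracket on ℝ⁴ with coordinates (q₁, q₂, p₁, p₂). -/
noncomputable def poissonBracket (F G : ℝ → ℝ → ℝ → ℝ → ℝ) (q₁ q₂ p₁ p₂ : ℝ) : ℝ :=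
    deriv (fun x => F x q₂ p₁ p₂) q₁ * deriv (fun x => G q₁ q₂ x p₂) p₁
  + deriv (fun x => F q₁ x p₁ p₂) q₂ * deriv (fun x => G q₁ q₂ p₁ x) p₂
  - deriv (fun x => F q₁ q₂ x p₂) p₁ * deriv (fun x => G x q₂ p₁ p₂) q₁
  - deriv (fun x => F q₁ q₂ p₁ x) p₂ * deriv (fun x => G q₁ x p₁ p₂) q₂

theorem deriv_cubic_aux (f : ℝ → ℝ) (a b c d x : ℝ)
    (h : ∀ y, f y = a * y ^ 3 + b * y ^ 2 + c * y + d) :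
    deriv f x = 3 * a * x ^ 2 + 2 * b * x + c := by
  have hf : f = fun y => a * y ^ 3 + b * y ^ 2 + c * y + d := funext h
  rw [hf]
  have h3 := ((hasDerivAt_id x).pow 3).const_mul a
  have h2 := ((hasDerivAt_id x).pow 2).const_mul b
  have h1 := (hasDerivAt_id x).const_mul c
  have := (((h3.add h2).add h1).add_const d).deriv
  refine Eq.trans this ?_
  simp
  ring

/-- The function `C_R` is a constant of motion of the Fokas–Lagerstrom Hamiltonian. -/
theorem fokas_lagerstrom_CR_constant_of_motion :
    ∀ q₁ q₂ p₁ p₂ : ℝ,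
      poissonBracket
        (fun q₁ q₂ p₁ p₂ => (1/2) * (p₁^2 + p₂^2) + (1/2) * q₁^2 + (1/18) * q₂^2)
        (fun q₁ q₂ p₁ p₂ =>
          p₂^2 * (p₁ * p₂ + q₁ * q₂) - (q₂^2 / 3) * (p₁ * p₂ + (1/9) * q₁ * q₂))
        q₁ q₂ p₁ p₂ = 0 := by
  intro q₁ q₂ p₁ p₂
  unfold poissonBracket
  rw [deriv_cubic_aux _ 0 (1/2) 0 ((1/2) * (p₁^2 + p₂^2) + (1/18) * q₂^2) q₁ (by intro y; ring),
    deriv_cubic_aux _ 0 0 (p₂^3 - q₂^2 * p₂ / 3) (q₁ * q₂ * p₂^2 - q₁ * q₂^3 / 27) p₁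
      (by intro y; ring),
    deriv_cubic_aux _ 0 (1/18) 0 ((1/2) * (p₁^2 + p₂^2) + (1/2) * q₁^2) q₂ (by intro y; ring),
    deriv_cubic_aux _ p₁ (q₁ * q₂) (-(q₂^2 * p₁ / 3)) (-(q₁ * q₂^3 / 27)) p₂
      (by intro y; ring),
    deriv_cubic_aux _ 0 (1/2) 0 ((1/2) * p₂^2 + (1/2) * q₁^2 + (1/18) * q₂^2) p₁
      (by intro y; ring),
    deriv_cubic_aux _ 0 0 (q₂ * p₂^2 - q₂^3 / 27) (p₁ * p₂^3 - q₂^2 * p₁ * p₂ / 3) q₁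
      (by intro y; ring),
    deriv_cubic_aux _ 0 (1/2) 0 ((1/2) * p₁^2 + (1/2) * q₁^2 + (1/18) * q₂^2) p₂
      (by intro y; ring),
    deriv_cubic_aux _ (-(q₁ / 27)) (-(p₁ * p₂ / 3)) (q₁ * p₂^2) (p₁ * p₂^3) q₂
      (by intro y; ring)]
  ring
end

section
/- Let λ₁, λ₂, μ₁, μ₂, k₁, k₂ ∈ ℝ and let H = (1/2)p₁²(λ₁ + μ₁q₁²)³ + (1/2)p₂²(λ₂ + μ₂q₂²)³ + k₁/q₁² + k₂/q₂² on the open set {q₁ ≠ 0, q₂ ≠ 0} ⊂ ℝ⁴. For i = 1, 2 set T_i = (λ_i q_i + μ_i q_i³) p_i and I_i = (λ_i + μ_i q_i²)[λ_i(λ_i + μ_i q_i²)²p_i² + 2k_i/q_i²]. Then {T_i, H} = I_i for i = 1, 2; in particular T_i is a generator of constants of motion of degree 1 for H, i.e. {T_i,H} ≠ 0 generically and {{T_i, H}, H} = 0. -/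
/-- The position-dependent-mass Smorodinsky–Winternitz Hamiltonian. -/
noncomputable def pdmSW (lam₁ lam₂ mu₁ mu₂ k₁ k₂ : ℝ) : ℝ → ℝ → ℝ → ℝ → ℝ :=
  fun q₁ q₂ p₁ p₂ =>
    (1/2) * p₁^2 * (lam₁ + mu₁ * q₁^2)^3 + (1/2) * p₂^2 * (lam₂ + mu₂ * q₂^2)^3
      + k₁ / q₁^2 + k₂ / q₂^2

/-- Master symmetry generator `T₁ = (λ₁q₁ + μ₁q₁³)p₁`. -/
noncomputable def Tgen₁ (lam₁ mu₁ : ℝ) : ℝ → ℝ → ℝ → ℝ → ℝ :=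
  fun q₁ _ p₁ _ => (lam₁ * q₁ + mu₁ * q₁^3) * p₁

/-- Master symmetry generator `T₂ = (λ₂q₂ + μ₂q₂³)p₂`. -/
noncomputable def Tgen₂ (lam₂ mu₂ : ℝ) : ℝ → ℝ → ℝ → ℝ → ℝ :=
  fun _ q₂ _ p₂ => (lam₂ * q₂ + mu₂ * q₂^3) * p₂

/-- First integral `I₁ = (λ₁ + μ₁q₁²)[λ₁(λ₁ + μ₁q₁²)²p₁² + 2k₁/q₁²]`. -/
noncomputable def Int₁ (lam₁ mu₁ k₁ : ℝ) : ℝ → ℝ → ℝ → ℝ → ℝ :=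
  fun q₁ _ p₁ _ => (lam₁ + mu₁ * q₁^2) * (lam₁ * (lam₁ + mu₁ * q₁^2)^2 * p₁^2 + 2 * k₁ / q₁^2)

/-- First integral `I₂ = (λ₂ + μ₂q₂²)[λ₂(λ₂ + μ₂q₂²)²p₂² + 2k₂/q₂²]`. -/
noncomputable def Int₂ (lam₂ mu₂ k₂ : ℝ) : ℝ → ℝ → ℝ → ℝ → ℝ :=
  fun _ q₂ _ p₂ => (lam₂ + mu₂ * q₂^2) * (lam₂ * (lam₂ + mu₂ * q₂^2)^2 * p₂^2 + 2 * k₂ / q₂^2)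

theorem aux_a (l m x : ℝ) (n : ℕ) :
    HasDerivAt (fun x : ℝ => (l + m * x^2)^n) (n * (l + m * x^2)^(n-1) * (2 * m * x)) x := by
  have h := ((((hasDerivAt_id' x).pow 2).const_mul m).const_add l).pow n
  refine h.congr_deriv ?_
  simp only [Pi.pow_apply]
  push_cast
  ring

theorem aux_k (k x : ℝ) (hx : x ≠ 0) :
    HasDerivAt (fun x : ℝ => k / x^2) (-2 * k / x^3) x := by
  have h := (hasDerivAt_const x k).div ((hasDerivAt_id' x).pow 2) (by simpa using hx)
  refine h.congr_deriv ?_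
  norm_num
  field_simp

theorem aux_p (c x : ℝ) : HasDerivAt (fun x : ℝ => c * x^2) (c * (2 * x)) x := by
  have h := ((hasDerivAt_id' x).pow 2).const_mul c
  refine h.congr_deriv ?_
  norm_num

theorem Hq1 (l1 l2 m1 m2 k1 k2 q1 q2 p1 p2 : ℝ) (h : q1 ≠ 0) :
    deriv (fun x => pdmSW l1 l2 m1 m2 k1 k2 x q2 p1 p2) q1
      = 3 * p1^2 * (l1 + m1*q1^2)^2 * m1 * q1 - 2 * k1 / q1^3 := by
  unfold pdmSW
  refine ((((((aux_a l1 m1 q1 3).const_mul (1/2*p1^2)).add_const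
    (1/2*p2^2*(l2+m2*q2^2)^3)).add (aux_k k1 q1 h)).add_const (k2/q2^2)).deriv).trans ?_
  norm_num
  ring

theorem Hp1 (l1 l2 m1 m2 k1 k2 q1 q2 p1 p2 : ℝ) :
    deriv (fun x => pdmSW l1 l2 m1 m2 k1 k2 q1 q2 x p2) p1
      = p1 * (l1 + m1*q1^2)^3 := by
  unfold pdmSW
  rw [(((((aux_p (1/2) p1).mul_const ((l1 + m1*q1^2)^3)).add_const
    (1/2*p2^2*(l2+m2*q2^2)^3)).add_const (k1/q1^2)).add_const (k2/q2^2)).deriv]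
  ring

theorem H_swap (l1 l2 m1 m2 k1 k2 q1 q2 p1 p2 : ℝ) :
    pdmSW l1 l2 m1 m2 k1 k2 q1 q2 p1 p2 = pdmSW l2 l1 m2 m1 k2 k1 q2 q1 p2 p1 := by
  unfold pdmSW
  ring

theorem pb_swap (F G : ℝ → ℝ → ℝ → ℝ → ℝ) (q1 q2 p1 p2 : ℝ) :
    poissonBracket F G q1 q2 p1 p2 =
     poissonBracket (fun a b c d => F b a d c) (fun a b c d => G b a d c) q2 q1 p2 p1 := by
  unfold poissonBracket
  ring

theorem T1 (l1 l2 m1 m2 k1 k2 q1 q2 p1 p2 : ℝ) (h : q1 ≠ 0) :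
    poissonBracket (Tgen₁ l1 m1) (pdmSW l1 l2 m1 m2 k1 k2) q1 q2 p1 p2
        = Int₁ l1 m1 k1 q1 q2 p1 p2 := by
  have e1 : deriv (fun x : ℝ => (l1 * x + m1 * x^3) * p1) q1 = (l1 + 3 * m1 * q1^2) * p1 := by
    have := ((((hasDerivAt_id' q1).const_mul l1).add
      (((hasDerivAt_id' q1).pow 3).const_mul m1)).mul_const p1).deriv
    refine this.trans ?_
    push_cast
    ring
  have e2 : deriv (fun x : ℝ => (l1 * q1 + m1 * q1^3) * x) p1 = (l1 * q1 + m1 * q1^3) := by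
    simpa using ((hasDerivAt_id' p1).const_mul (l1 * q1 + m1 * q1^3)).deriv
  unfold poissonBracket
  rw [Hq1 _ _ _ _ _ _ _ _ _ _ h, Hp1]
  simp only [Tgen₁, Int₁, e1, e2, deriv_const]
  field_simp
  ring

theorem I1 (l1 l2 m1 m2 k1 k2 q1 q2 p1 p2 : ℝ) (h : q1 ≠ 0) :
    poissonBracket (Int₁ l1 m1 k1) (pdmSW l1 l2 m1 m2 k1 k2) q1 q2 p1 p2 = 0 := by
  have e1 : deriv (fun x : ℝ => (l1 + m1 * x^2) * (l1 * (l1 + m1 * x^2)^2 * p1^2 + 2 * k1 / x^2)) q1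
      = 2 * m1 * q1 * (l1 * (l1 + m1 * q1^2)^2 * p1^2 + 2 * k1 / q1^2)
       + (l1 + m1 * q1^2) * (l1 * (2 * (l1 + m1 * q1^2) * (2 * m1 * q1)) * p1^2
          + -2 * (2 * k1) / q1^3) := by
    have a := aux_a l1 m1 q1 1
    simp only [pow_one] at a
    have := (a.mul ((((aux_a l1 m1 q1 2).const_mul l1).mul_const (p1^2)).add
      (aux_k (2*k1) q1 h))).deriv
    refine this.trans ?_
    norm_num
  have e2 : deriv (fun x : ℝ => (l1 + m1 * q1^2) * (l1 * (l1 + m1 * q1^2)^2 * x^2 + 2 * k1 / q1^2)) p1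
      = (l1 + m1 * q1^2) * (l1 * (l1 + m1 * q1^2)^2 * (2 * p1)) :=
    (((aux_p (l1 * (l1 + m1 * q1^2)^2) p1).add_const (2 * k1 / q1^2)).const_mul
      (l1 + m1 * q1^2)).deriv
  unfold poissonBracket
  rw [Hq1 _ _ _ _ _ _ _ _ _ _ h, Hp1]
  simp only [Int₁, e1, e2, deriv_const]
  field_simp
  ring

theorem T2 (l1 l2 m1 m2 k1 k2 q1 q2 p1 p2 : ℝ) (h : q2 ≠ 0) :
    poissonBracket (Tgen₂ l2 m2) (pdmSW l1 l2 m1 m2 k1 k2) q1 q2 p1 p2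
        = Int₂ l2 m2 k2 q1 q2 p1 p2 := by
  rw [pb_swap]
  simp only [H_swap l1 l2]
  exact T1 l2 l1 m2 m1 k2 k1 q2 q1 p2 p1 h

theorem I2 (l1 l2 m1 m2 k1 k2 q1 q2 p1 p2 : ℝ) (h : q2 ≠ 0) :
    poissonBracket (Int₂ l2 m2 k2) (pdmSW l1 l2 m1 m2 k1 k2) q1 q2 p1 p2 = 0 := by
  rw [pb_swap]
  simp only [H_swap l1 l2]
  exact I1 l2 l1 m2 m1 k2 k1 q2 q1 p2 p1 h

theorem nonv (l m k : ℝ) (h : l ≠ 0 ∨ (m ≠ 0 ∧ k ≠ 0)) :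
    ∃ q p : ℝ, q ≠ 0 ∧
      (l + m * q^2) * (l * (l + m * q^2)^2 * p^2 + 2 * k / q^2) ≠ 0 := by
  by_cases hl : l = 0
  · obtain ⟨hm, hk⟩ := h.resolve_left (by simpa using hl)
    exact ⟨1, 0, one_ne_zero, by simp [hl, hm, hk]⟩
  · obtain ⟨q, hq, ha⟩ : ∃ q : ℝ, q ≠ 0 ∧ l + m * q^2 ≠ 0 := by
      by_contra! hc
      have h1 := hc 1 (by norm_num)
      have h2 := hc 2 (by norm_num)
      apply hl
      linarith
    by_contra! hc
    have h0 := (mul_eq_zero.1 (hc q 0 hq)).resolve_left ha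
    have h1 := (mul_eq_zero.1 (hc q 1 hq)).resolve_left ha
    have : l * (l + m * q^2)^2 = 0 := by linarith
    simp [hl, ha] at this

/-- `{T_i, H} = I_i` for `i = 1, 2`; in particular each `T_i` is a master symmetry generator
of degree 1 for the position-dependent-mass Smorodinsky–Winternitz Hamiltonian:
`{T_i, H}` is not identically zero (in the nondegenerate cases) and `{{T_i, H}, H} = 0`. -/
theorem pdm_SW_master_symmetry_generators (lam₁ lam₂ mu₁ mu₂ k₁ k₂ : ℝ) :
    (∀ q₁ q₂ p₁ p₂ : ℝ, q₁ ≠ 0 → q₂ ≠ 0 →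
      poissonBracket (Tgen₁ lam₁ mu₁) (pdmSW lam₁ lam₂ mu₁ mu₂ k₁ k₂) q₁ q₂ p₁ p₂
        = Int₁ lam₁ mu₁ k₁ q₁ q₂ p₁ p₂ ∧
      poissonBracket (Tgen₂ lam₂ mu₂) (pdmSW lam₁ lam₂ mu₁ mu₂ k₁ k₂) q₁ q₂ p₁ p₂
        = Int₂ lam₂ mu₂ k₂ q₁ q₂ p₁ p₂ ∧
      poissonBracket (Int₁ lam₁ mu₁ k₁) (pdmSW lam₁ lam₂ mu₁ mu₂ k₁ k₂) q₁ q₂ p₁ p₂ = 0 ∧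
      poissonBracket (Int₂ lam₂ mu₂ k₂) (pdmSW lam₁ lam₂ mu₁ mu₂ k₁ k₂) q₁ q₂ p₁ p₂ = 0) ∧
    ((lam₁ ≠ 0 ∨ (mu₁ ≠ 0 ∧ k₁ ≠ 0)) →
      ∃ q₁ q₂ p₁ p₂ : ℝ, q₁ ≠ 0 ∧ q₂ ≠ 0 ∧
        poissonBracket (Tgen₁ lam₁ mu₁) (pdmSW lam₁ lam₂ mu₁ mu₂ k₁ k₂) q₁ q₂ p₁ p₂ ≠ 0) ∧
    ((lam₂ ≠ 0 ∨ (mu₂ ≠ 0 ∧ k₂ ≠ 0)) →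
      ∃ q₁ q₂ p₁ p₂ : ℝ, q₁ ≠ 0 ∧ q₂ ≠ 0 ∧
        poissonBracket (Tgen₂ lam₂ mu₂) (pdmSW lam₁ lam₂ mu₁ mu₂ k₁ k₂) q₁ q₂ p₁ p₂ ≠ 0) := by
  refine ⟨fun q₁ q₂ p₁ p₂ h1 h2 => ⟨T1 _ _ _ _ _ _ _ _ _ _ h1, T2 _ _ _ _ _ _ _ _ _ _ h2,
    I1 _ _ _ _ _ _ _ _ _ _ h1, I2 _ _ _ _ _ _ _ _ _ _ h2⟩, fun h => ?_, fun h => ?_⟩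
  · obtain ⟨q, p, hq, hn⟩ := nonv _ _ _ h
    refine ⟨q, 1, p, 0, hq, one_ne_zero, ?_⟩
    rw [T1 _ _ _ _ _ _ _ _ _ _ hq]
    exact hn
  · obtain ⟨q, p, hq, hn⟩ := nonv _ _ _ h
    refine ⟨1, q, 0, p, one_ne_zero, hq, ?_⟩
    rw [T2 _ _ _ _ _ _ _ _ _ _ hq]
    exact hn
end

section
/- Let λ₁, λ₂, μ₁, μ₂, k₁, k₂ ∈ ℝ and let H = (1/2)p₁²(λ₁ + μ₁q₁²)³ + (1/2)p₂²(λ₂ + μ₂q₂²)³ + k₁/q₁² + k₂/q₂² on the open set {q₁ ≠ 0, q₂ ≠ 0} ⊂ ℝ⁴. Then the function I₁₂ = (λ₁ + μ₁q₁²)(λ₂ + μ₂q₂²)[((λ₂ + μ₂q₂²)²λ₂p₂² + 2k₂/q₂²) q₁p₁ − ((λ₁ + μ₁q₁²)²λ₁p₁² + 2k₁/q₁²) q₂p₂] satisfies {H, I₁₂} = 0, i.e. I₁₂ is an additional time-independent constant of motion of the position-dependent-mass Smorodinsky–Winternitz system. -/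
theorem hA (l m q : ℝ) : HasDerivAt (fun x : ℝ => l + m * x^2) (2 * m * q) q := by
  have h := ((hasDerivAt_pow 2 q).const_mul m).const_add l
  refine h.congr_deriv ?_
  push_cast; ring

theorem hK (k q : ℝ) (hq : q ≠ 0) : HasDerivAt (fun x : ℝ => k / x^2) (-2 * k / q^3) q := by
  have h := (hasDerivAt_const q k).div (hasDerivAt_pow 2 q) (pow_ne_zero 2 hq)
  refine h.congr_deriv ?_
  push_cast; field_simp; ring

theorem hP (q : ℝ) : HasDerivAt (fun x : ℝ => x^2) (2 * q) q := by
  have h := hasDerivAt_pow 2 q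
  refine h.congr_deriv ?_
  push_cast; ring

/-- The additional time-independent constant of motion
`I₁₂ = (λ₁+μ₁q₁²)(λ₂+μ₂q₂²)[((λ₂+μ₂q₂²)²λ₂p₂² + 2k₂/q₂²)q₁p₁ − ((λ₁+μ₁q₁²)²λ₁p₁² + 2k₁/q₁²)q₂p₂]`
of the position-dependent-mass Smorodinsky–Winternitz system. -/
theorem pdm_SW_additional_integral (lam₁ lam₂ mu₁ mu₂ k₁ k₂ : ℝ) :
    ∀ q₁ q₂ p₁ p₂ : ℝ, q₁ ≠ 0 → q₂ ≠ 0 →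
      poissonBracket
        (fun q₁ q₂ p₁ p₂ =>
          (1/2) * p₁^2 * (lam₁ + mu₁ * q₁^2)^3 + (1/2) * p₂^2 * (lam₂ + mu₂ * q₂^2)^3
            + k₁ / q₁^2 + k₂ / q₂^2)
        (fun q₁ q₂ p₁ p₂ =>
          (lam₁ + mu₁ * q₁^2) * (lam₂ + mu₂ * q₂^2) *
            (((lam₂ + mu₂ * q₂^2)^2 * lam₂ * p₂^2 + 2 * k₂ / q₂^2) * q₁ * p₁
              - ((lam₁ + mu₁ * q₁^2)^2 * lam₁ * p₁^2 + 2 * k₁ / q₁^2) * q₂ * p₂))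
        q₁ q₂ p₁ p₂ = 0 := by
  intro q₁ q₂ p₁ p₂ h₁ h₂
  unfold poissonBracket
  have a1 := hA lam₁ mu₁ q₁
  have a2 := hA lam₂ mu₂ q₂
  have F1 := (((((a1.pow 3).const_mul ((1/2) * p₁^2)).add_const
    ((1/2) * p₂^2 * (lam₂ + mu₂ * q₂^2)^3)).add (hK k₁ q₁ h₁)).add_const (k₂ / q₂^2)).deriv
  have F2 := (((((a2.pow 3).const_mul ((1/2) * p₂^2)).const_add
    ((1/2) * p₁^2 * (lam₁ + mu₁ * q₁^2)^3)).add_const (k₁ / q₁^2)).add (hK k₂ q₂ h₂)).deriv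
  have F3 := ((((((hP p₁).const_mul (1/2)).mul_const ((lam₁ + mu₁ * q₁^2)^3)).add_const
    ((1/2) * p₂^2 * (lam₂ + mu₂ * q₂^2)^3)).add_const (k₁ / q₁^2)).add_const (k₂ / q₂^2)).deriv
  have F4 := ((((((hP p₂).const_mul (1/2)).mul_const ((lam₂ + mu₂ * q₂^2)^3)).const_add
    ((1/2) * p₁^2 * (lam₁ + mu₁ * q₁^2)^3)).add_const (k₁ / q₁^2)).add_const (k₂ / q₂^2)).deriv
  have G1 := ((a1.mul_const (lam₂ + mu₂ * q₂^2)).mul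
    ((((hasDerivAt_id q₁).const_mul ((lam₂ + mu₂ * q₂^2)^2 * lam₂ * p₂^2 + 2 * k₂ / q₂^2)).mul_const
      p₁).sub ((((((a1.pow 2).mul_const lam₁).mul_const (p₁^2)).add
        (hK (2 * k₁) q₁ h₁)).mul_const q₂).mul_const p₂))).deriv
  have G2 := ((a2.const_mul (lam₁ + mu₁ * q₁^2)).mul
    (((((((a2.pow 2).mul_const lam₂).mul_const (p₂^2)).add
        (hK (2 * k₂) q₂ h₂)).mul_const q₁).mul_const p₁).sub
     (((hasDerivAt_id q₂).const_mul
      ((lam₁ + mu₁ * q₁^2)^2 * lam₁ * p₁^2 + 2 * k₁ / q₁^2)).mul_const p₂))).deriv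
  have G3 := ((((hasDerivAt_id p₁).const_mul
      (((lam₂ + mu₂ * q₂^2)^2 * lam₂ * p₂^2 + 2 * k₂ / q₂^2) * q₁)).sub
      ((((((hP p₁).const_mul ((lam₁ + mu₁ * q₁^2)^2 * lam₁)).add_const
        (2 * k₁ / q₁^2)).mul_const q₂).mul_const p₂))).const_mul
      ((lam₁ + mu₁ * q₁^2) * (lam₂ + mu₂ * q₂^2))).deriv
  have G4 := (((((((hP p₂).const_mul ((lam₂ + mu₂ * q₂^2)^2 * lam₂)).add_const
        (2 * k₂ / q₂^2)).mul_const q₁).mul_const p₁).sub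
      ((hasDerivAt_id p₂).const_mul
      (((lam₁ + mu₁ * q₁^2)^2 * lam₁ * p₁^2 + 2 * k₁ / q₁^2) * q₂))).const_mul
      ((lam₁ + mu₁ * q₁^2) * (lam₂ + mu₂ * q₂^2))).deriv
  refine (congrArg₂ (· - ·) (congrArg₂ (· - ·) (congrArg₂ (· + ·) (congrArg₂ (· * ·) F1 G3)
    (congrArg₂ (· * ·) F2 G4)) (congrArg₂ (· * ·) F3 G1)) (congrArg₂ (· * ·) F4 G2)).trans ?_
  simp only [Pi.pow_apply, Pi.add_apply, Pi.sub_apply, Pi.mul_apply, id]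
  push_cast
  field_simp
  ring
end
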